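/- Let ρ > 1 and w(k) = k^ρ for all k ≥ 1, and fix integers a, b ≥ 1. Then the expected attraction time E^{a,b}[T] (expectation of T under P^{a,b}, as an extended real number) is infinite if ρ ≤ (3+√5)/2 = 1 + (1+√5)/2, and finite if ρ > (3+√5)/2. -/

import Mathlib

/-!
Statement 0 (Proposition 2(a) of Cotar–Limic, "Attraction time for strongly
reinforced walks").

Setup: `w : ℕ → ℝ` is a reinforcement weight function, positive on `{1,2,...}`,
satisfying (A0): `∑_{k ≥ 1} 1/w(k) < ∞`.  The two-edge ERRW with law `P^{a,b}`
is the Markov chain `(G_n, R_n)_{n ≥ a+b}` with `(G_{a+b}, R_{a+b}) = (a,b)`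
which moves from `(g,r)` to `(g+1,r)` with probability `w(g)/(w(g)+w(r))` and to
`(g,r+1)` with probability `w(r)/(w(g)+w(r))`.  We encode a trajectory by the
sequence of choices `ω : ℕ → Bool` (`true` = green edge incremented), and we
characterize the law `P` by its values on cylinder sets.
-/

open MeasureTheory Finset

namespace AttractionTime

/-- Number of green increments among the first `i` steps. -/
def greenCount (ω : ℕ → Bool) (i : ℕ) : ℕ :=
  ((Finset.range i).filter fun j => ω j = true).card

/-- Green edge weight after `i` steps, starting from `a`. -/
def Gw (a : ℕ) (ω : ℕ → Bool) (i : ℕ) : ℕ := a + greenCount ω i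

/-- Red edge weight after `i` steps, starting from `b`. -/
def Rw (b : ℕ) (ω : ℕ → Bool) (i : ℕ) : ℕ := b + (i - greenCount ω i)

/-- Transition probability of the `i`-th step of the trajectory `s`. -/
noncomputable def stepProb (w : ℕ → ℝ) (a b : ℕ) (s : ℕ → Bool) (i : ℕ) : ℝ :=
  if s i then w (Gw a s i) / (w (Gw a s i) + w (Rw b s i))
  else w (Rw b s i) / (w (Gw a s i) + w (Rw b s i))

/-- `Z_n = min (G_n, R_n)`, where time `n ≥ a+b` corresponds to `n - (a+b)` steps. -/
def Z (a b : ℕ) (ω : ℕ → Bool) (n : ℕ) : ℕ :=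
  min (Gw a ω (n - (a + b))) (Rw b ω (n - (a + b)))

/-- `Z_∞ = sup_n Z_n ∈ ℕ ∪ {∞}`. -/
noncomputable def Zinf (a b : ℕ) (ω : ℕ → Bool) : ℕ∞ := ⨆ n, (Z a b ω n : ℕ∞)

/-- The law `P^{a,b}` : a probability measure on trajectories whose cylinder
probabilities are the products of the transition probabilities. -/
def IsTwoEdgeLaw (w : ℕ → ℝ) (a b : ℕ) (P : Measure (ℕ → Bool)) : Prop :=
  ∀ (m : ℕ) (s : ℕ → Bool),
    (P {ω | ∀ i < m, ω i = s i}).toReal = ∏ i ∈ Finset.range m, stepProb w a b s i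

end AttractionTime

open AttractionTime

namespace AttractionTime

/-- The attraction time `T := inf {k ≥ a+b : Z_l = Z_{l+1} for all l ≥ k}`,
with `T = ∞` if no such `k` exists. -/
noncomputable def Tattr (a b : ℕ) (ω : ℕ → Bool) : ℕ∞ :=
  sInf {t : ℕ∞ | ∃ k : ℕ, t = (k : ℕ∞) ∧ a + b ≤ k ∧
    ∀ l, k ≤ l → Z a b ω l = Z a b ω (l + 1)}

/-- `W_k(ℓ) := ∏_{j=0}^∞ w(k+j-ℓ)/(w(k+j-ℓ)+w(ℓ))`. -/
noncomputable def W (w : ℕ → ℝ) (k ℓ : ℕ) : ℝ :=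
  ∏' j : ℕ, w (k + j - ℓ) / (w (k + j - ℓ) + w ℓ)

end AttractionTime

namespace AttractionTime

section Paths

lemma greenCount_succ (ω : ℕ → Bool) (i : ℕ) :
    greenCount ω (i + 1) = greenCount ω i + if ω i = true then 1 else 0 := by
  unfold greenCount
  rw [Finset.range_add_one, Finset.filter_insert]
  split_ifs with h
  · rw [Finset.card_insert_of_notMem (by simp)]
  · rfl

@[simp] lemma greenCount_zero (ω : ℕ → Bool) : greenCount ω 0 = 0 := rfl

lemma greenCount_le (ω : ℕ → Bool) (i : ℕ) : greenCount ω i ≤ i := by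
  simpa [greenCount] using Finset.card_filter_le (Finset.range i) fun j => ω j = true

lemma greenCount_congr {ω ω' : ℕ → Bool} {i : ℕ} (h : ∀ j < i, ω j = ω' j) :
    greenCount ω i = greenCount ω' i := by
  unfold greenCount
  congr 1
  exact Finset.filter_congr fun j hj => by rw [h j (Finset.mem_range.1 hj)]

lemma stepProb_congr (w : ℕ → ℝ) (a b : ℕ) {ω ω' : ℕ → Bool} {i : ℕ}
    (h : ∀ j ≤ i, ω j = ω' j) : stepProb w a b ω i = stepProb w a b ω' i := by
  simp only [stepProb, Gw, Rw, greenCount_congr fun j hj => h j (le_of_lt hj), h i le_rfl]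

/-- Trajectories agreeing with `s` during the first `m` steps. -/
def cyl (m : ℕ) (s : ℕ → Bool) : Set (ℕ → Bool) := {ω | ∀ i < m, ω i = s i}

lemma measurableSet_coord (i : ℕ) (x : Bool) : MeasurableSet {ω : ℕ → Bool | ω i = x} :=
  (measurable_pi_apply (X := fun _ => Bool) i) (measurableSet_singleton x)

lemma measurableSet_cyl (m : ℕ) (s : ℕ → Bool) : MeasurableSet (cyl m s) := by
  have : cyl m s = ⋂ i, ⋂ (_ : i < m), {ω | ω i = s i} := by ext; simp [cyl]
  rw [this]
  exact MeasurableSet.iInter fun i => MeasurableSet.iInter fun _ => measurableSet_coord i _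

lemma measurable_greenCount (i : ℕ) : Measurable fun ω => greenCount ω i := by
  induction i with
  | zero => simp
  | succ i ih =>
    simp only [greenCount_succ]
    exact ih.add (Measurable.ite (measurableSet_coord i true) measurable_const measurable_const)

/-- Trajectories at green count `c` and red count `d` which then take the step `x`. -/
def stepAt (x : Bool) (c d : ℕ) : Set (ℕ → Bool) :=
  {ω | greenCount ω (c + d) = c ∧ ω (c + d) = x}

/-- Trajectories passing through green count `c` and red count `d`. -/
def visit (c d : ℕ) : Set (ℕ → Bool) := {ω | greenCount ω (c + d) = c}

lemma measurableSet_visit (c d : ℕ) : MeasurableSet (visit c d) :=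
  measurable_greenCount (c + d) (measurableSet_singleton c)

lemma measurableSet_stepAt (x : Bool) (c d : ℕ) : MeasurableSet (stepAt x c d) :=
  (measurableSet_visit c d).inter (measurableSet_coord _ x)

lemma visit_succ_succ (c d : ℕ) :
    visit (c + 1) (d + 1) = stepAt true c (d + 1) ∪ stepAt false (c + 1) d := by
  ext ω
  simp only [visit, stepAt, Set.mem_ofPred_eq, Set.mem_union]
  rw [show c + 1 + (d + 1) = (c + 1 + d) + 1 by ring, show c + (d + 1) = c + 1 + d by ring,
    greenCount_succ]
  cases ω (c + 1 + d) <;> simp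

lemma visit_succ_zero (c : ℕ) : visit (c + 1) 0 = stepAt true c 0 := by
  ext ω
  have := greenCount_le ω c
  simp only [visit, stepAt, Set.mem_ofPred_eq, add_zero, greenCount_succ]
  cases ω c <;> simp
  omega

lemma visit_zero_succ (d : ℕ) : visit 0 (d + 1) = stepAt false 0 d := by
  ext ω
  simp only [visit, stepAt, Set.mem_ofPred_eq, zero_add, greenCount_succ]
  cases ω d <;> simp

end Paths

section Law

lemma measureReal_iUnion_le_of_sum_le {Ω : Type*} [MeasurableSpace Ω] {P : Measure Ω}
    [IsFiniteMeasure P] {s : ℕ → Set Ω} {C : ℝ}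
    (h : ∀ n, ∑ j ∈ Finset.range n, P.real (s j) ≤ C) : P.real (⋃ j, s j) ≤ C := by
  have hC : 0 ≤ C := by simpa using h 0
  refine ENNReal.toReal_le_of_le_ofReal hC ((measure_iUnion_le s).trans ?_)
  refine ENNReal.tsum_le_of_sum_range_le fun n => ?_
  refine le_trans (le_of_eq ?_) (ENNReal.ofReal_le_ofReal (h n))
  rw [ENNReal.ofReal_sum_of_nonneg fun _ _ => measureReal_nonneg]
  exact Finset.sum_congr rfl fun j _ => by simp [measureReal_def]

variable {w : ℕ → ℝ} {a b : ℕ} {P : Measure (ℕ → Bool)}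

lemma IsTwoEdgeLaw.real_cyl_succ (hP : IsTwoEdgeLaw w a b P) (m : ℕ) (s : ℕ → Bool) :
    P.real (cyl (m + 1) s) = P.real (cyl m s) * stepProb w a b s m := by
  have h := hP (m + 1) s
  rwa [Finset.prod_range_succ, ← hP m s] at h

/-- Conditionally on an event determined by the first `i` steps, on which the green count is
`c`, the next step follows the transition probabilities of the walk. -/
lemma IsTwoEdgeLaw.real_inter_step [IsProbabilityMeasure P] (hP : IsTwoEdgeLaw w a b P)
    {A : Set (ℕ → Bool)} {i c : ℕ}
    (hA : ∀ ω ω', (∀ j < i, ω j = ω' j) → ω ∈ A → ω' ∈ A)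
    (hc : ∀ ω ∈ A, greenCount ω i = c) (x : Bool) :
    P.real (A ∩ {ω | ω i = x}) =
      P.real A * ((if x then w (a + c) else w (b + (i - c))) / (w (a + c) + w (b + (i - c)))) := by
  classical
  let ext : (Fin i → Bool) → ℕ → Bool := fun s j => if h : j < i then s ⟨j, h⟩ else x
  have hext : ∀ s, ext s i = x := fun s => by simp [ext]
  let S : Finset (Fin i → Bool) := Finset.univ.filter fun s => ext s ∈ A
  have hAS : A = ⋃ s ∈ S, cyl i (ext s) := by
    ext ω
    simp only [Set.mem_iUnion, exists_prop]
    constructor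
    · intro h
      have he : ∀ j < i, ω j = ext (fun k => ω k) j := fun j hj => by simp [ext, hj]
      exact ⟨fun k => ω k, by simpa [S] using hA _ _ he h, he⟩
    · rintro ⟨s, hs, h⟩
      exact hA _ _ (fun j hj => (h j hj).symm) (by simpa [S] using hs)
  have hAS' : A ∩ {ω | ω i = x} = ⋃ s ∈ S, cyl (i + 1) (ext s) := by
    conv_lhs => rw [hAS]
    ext ω
    simp only [Set.mem_inter_iff, Set.mem_iUnion, exists_prop, Set.mem_ofPred_eq]
    constructor
    · rintro ⟨⟨s, hs, h⟩, hx⟩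
      refine ⟨s, hs, fun j hj => ?_⟩
      rcases Nat.lt_succ_iff_lt_or_eq.1 hj with hj | rfl
      · exact h j hj
      · rw [hx, hext]
    · rintro ⟨s, hs, h⟩
      exact ⟨⟨s, hs, fun j hj => h j (by omega)⟩, by rw [h i (by omega), hext]⟩
  have hdisj : ∀ m, i ≤ m → (S : Set (Fin i → Bool)).PairwiseDisjoint fun s => cyl m (ext s) := by
    intro m hm s _ t _ hst
    refine Set.disjoint_left.2 fun ω h1 h2 => hst ?_
    funext k
    have := (h1 k (by omega)).symm.trans (h2 k (by omega))
    simpa [ext] using this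
  have hsum : ∀ m, i ≤ m → P.real (⋃ s ∈ S, cyl m (ext s)) = ∑ s ∈ S, P.real (cyl m (ext s)) :=
    fun m hm => measureReal_biUnion_finset (hdisj m hm) fun s _ => measurableSet_cyl m _
  rw [hAS', hsum _ (Nat.le_succ i)]
  conv_rhs => rw [hAS, hsum i le_rfl, Finset.sum_mul]
  refine Finset.sum_congr rfl fun s hs => ?_
  rw [hP.real_cyl_succ]
  congr 1
  have : greenCount (ext s) i = c := hc _ (by simpa [S] using hs)
  simp only [stepProb, hext, Gw, Rw, this]
  split_ifs <;> rfl

lemma visit_congr {c d : ℕ} (ω ω' : ℕ → Bool) (h : ∀ j < c + d, ω j = ω' j)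
    (hω : ω ∈ visit c d) : ω' ∈ visit c d := by
  rw [visit, Set.mem_ofPred_eq, ← greenCount_congr h]
  exact hω

lemma IsTwoEdgeLaw.real_stepAt [IsProbabilityMeasure P] (hP : IsTwoEdgeLaw w a b P)
    (x : Bool) (c d : ℕ) :
    P.real (stepAt x c d) =
      P.real (visit c d) * ((if x then w (a + c) else w (b + d)) / (w (a + c) + w (b + d))) := by
  have := hP.real_inter_step (A := visit c d) (i := c + d) (c := c) visit_congr (fun _ h => h) x
  rwa [Nat.add_sub_cancel_left] at this

/-- The normalized visit probability: it satisfies a discrete maximum principle. -/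
noncomputable def density (w : ℕ → ℝ) (a b : ℕ) (P : Measure (ℕ → Bool)) (c d : ℕ) : ℝ :=
  P.real (visit c d) * (w (a + c) * w (b + d) / (w (a + c) + w (b + d)))

variable [IsProbabilityMeasure P] (hP : IsTwoEdgeLaw w a b P) (hw : ∀ k, 1 ≤ k → 0 < w k)
  (ha : 1 ≤ a) (hb : 1 ≤ b)

include hw ha hb

omit [IsProbabilityMeasure P] in
lemma density_nonneg (c d : ℕ) : 0 ≤ density w a b P c d := by
  have h1 := hw (a + c) (by omega)
  have h2 := hw (b + d) (by omega)
  unfold density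
  positivity

lemma density_zero_zero_pos : 0 < density w a b P 0 0 := by
  have h1 := hw a ha
  have h2 := hw b hb
  have : visit 0 0 = Set.univ := by ext; simp [visit]
  simp only [density, this, probReal_univ, add_zero, one_mul]
  positivity

include hP

lemma real_stepAt_true (c d : ℕ) :
    P.real (stepAt true c d) = density w a b P c d / w (b + d) := by
  have h1 := hw (a + c) (by omega)
  have h2 := hw (b + d) (by omega)
  rw [hP.real_stepAt, density]
  simp only [if_true]
  field_simp

lemma real_stepAt_false (c d : ℕ) :
    P.real (stepAt false c d) = density w a b P c d / w (a + c) := by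
  have h1 := hw (a + c) (by omega)
  have h2 := hw (b + d) (by omega)
  rw [hP.real_stepAt, density]
  simp only [Bool.false_eq_true, if_false]
  field_simp

lemma density_succ_succ (c d : ℕ) :
    density w a b P (c + 1) (d + 1) =
      (w (a + (c + 1)) * density w a b P c (d + 1) +
        w (b + (d + 1)) * density w a b P (c + 1) d) / (w (a + (c + 1)) + w (b + (d + 1))) := by
  have h1 := hw (a + (c + 1)) (by omega)
  have h2 := hw (b + (d + 1)) (by omega)
  have hd : Disjoint (stepAt true c (d + 1)) (stepAt false (c + 1) d) := by
    refine Set.disjoint_left.2 fun ω h h' => ?_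
    simp only [stepAt, Set.mem_ofPred_eq] at h h'
    rw [show c + (d + 1) = c + 1 + d by ring] at h
    simp [h.2] at h'
  rw [density, visit_succ_succ, measureReal_union hd (measurableSet_stepAt _ _ _),
    real_stepAt_true hP hw ha hb, real_stepAt_false hP hw ha hb]
  field_simp

lemma density_succ_zero (c : ℕ) :
    density w a b P (c + 1) 0 =
      w (a + (c + 1)) / (w (a + (c + 1)) + w b) * density w a b P c 0 := by
  have h1 := hw (a + (c + 1)) (by omega)
  have h2 := hw b (by omega)
  rw [density, visit_succ_zero, real_stepAt_true hP hw ha hb, add_zero]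
  field_simp

lemma density_zero_succ (d : ℕ) :
    density w a b P 0 (d + 1) =
      w (b + (d + 1)) / (w a + w (b + (d + 1))) * density w a b P 0 d := by
  have h1 := hw (b + (d + 1)) (by omega)
  have h2 := hw a (by omega)
  rw [density, visit_zero_succ, real_stepAt_false hP hw ha hb, add_zero]
  field_simp

lemma density_le (c d : ℕ) : density w a b P c d ≤ density w a b P 0 0 := by
  have h0 := (density_zero_zero_pos (P := P) hw ha hb).le
  induction c generalizing d with
  | zero =>
    induction d with
    | zero => rfl
    | succ d ih =>
      have h1 := hw (b + (d + 1)) (by omega)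
      have h2 := hw a (by omega)
      rw [density_zero_succ hP hw ha hb]
      exact (mul_le_of_le_one_left (density_nonneg hw ha hb _ _)
        ((div_le_one (by positivity)).2 (by linarith))).trans ih
  | succ c ihc =>
    have h1 := hw (a + (c + 1)) (by omega)
    induction d with
    | zero =>
      have h2 := hw b (by omega)
      rw [density_succ_zero hP hw ha hb]
      exact (mul_le_of_le_one_left (density_nonneg hw ha hb _ _)
        ((div_le_one (by positivity)).2 (by linarith))).trans (ihc 0)
    | succ d ih =>
      have h2 := hw (b + (d + 1)) (by omega)
      rw [density_succ_succ hP hw ha hb, div_le_iff₀ (by positivity)]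
      nlinarith [mul_le_mul_of_nonneg_left (ihc (d + 1)) h1.le,
        mul_le_mul_of_nonneg_left ih h2.le]

omit hP hw ha hb in
lemma exp_neg_le_div {x y : ℝ} (hx : 0 < x) (hy : 0 < y) : Real.exp (-(y * x⁻¹)) ≤ x / (x + y) := by
  have h : y * x⁻¹ + 1 ≤ Real.exp (y * x⁻¹) := Real.add_one_le_exp _
  rw [Real.exp_neg]
  calc _ ≤ (y * x⁻¹ + 1)⁻¹ := inv_anti₀ (by positivity) h
    _ = _ := by field_simp; ring

lemma le_density {S : ℝ} (hS : ∀ k n, 1 ≤ k → ∑ j ∈ Finset.range n, (w (k + j))⁻¹ ≤ S) (c d : ℕ) :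
    density w a b P 0 0 * Real.exp (-((w a + w b) * S)) ≤ density w a b P c d := by
  have h0 := density_zero_zero_pos (P := P) hw ha hb
  have hwa := hw a ha
  have hwb := hw b hb
  have hS0 : 0 ≤ S := by simpa using hS 1 0 le_rfl
  have hedge : ∀ (k n : ℕ) (v : ℝ), 1 ≤ k → v ≤ w a + w b → 0 < v →
      Real.exp (-((w a + w b) * S)) ≤
        Real.exp (-(v * ∑ j ∈ Finset.range n, (w (k + j))⁻¹)) := by
    intro k n v hk hv hv0
    gcongr
    · exact Finset.sum_nonneg fun j _ => (inv_pos.2 (hw _ (by omega))).le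
    · exact hS k n hk
  have hc0 : ∀ c, density w a b P 0 0 *
      Real.exp (-(w b * ∑ j ∈ Finset.range c, (w (a + 1 + j))⁻¹)) ≤ density w a b P c 0 := by
    intro c
    induction c with
    | zero => simp
    | succ c ih =>
      rw [density_succ_zero hP hw ha hb, Finset.sum_range_succ, mul_add, neg_add, Real.exp_add,
        ← mul_assoc, mul_comm]
      have hpos := hw (a + 1 + c) (by omega)
      have := exp_neg_le_div hpos hwb
      rw [show a + (c + 1) = a + 1 + c by ring]
      gcongr
  have h0d : ∀ d, density w a b P 0 0 *
      Real.exp (-(w a * ∑ j ∈ Finset.range d, (w (b + 1 + j))⁻¹)) ≤ density w a b P 0 d := by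
    intro d
    induction d with
    | zero => simp
    | succ d ih =>
      rw [density_zero_succ hP hw ha hb, Finset.sum_range_succ, mul_add, neg_add, Real.exp_add,
        ← mul_assoc, mul_comm]
      have hpos := hw (b + 1 + d) (by omega)
      have := exp_neg_le_div hpos hwa
      rw [show b + (d + 1) = b + 1 + d by ring, add_comm (w a)]
      gcongr
  induction c generalizing d with
  | zero =>
    exact (mul_le_mul_of_nonneg_left (hedge (b + 1) d (w a) (by omega) (by linarith) hwa)
      h0.le).trans (h0d d)
  | succ c ihc =>
    induction d with
    | zero =>
      exact (mul_le_mul_of_nonneg_left (hedge (a + 1) (c + 1) (w b) (by omega) (by linarith) hwb)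
        h0.le).trans (hc0 (c + 1))
    | succ d ih =>
      have h1 := hw (a + (c + 1)) (by omega)
      have h2 := hw (b + (d + 1)) (by omega)
      rw [density_succ_succ hP hw ha hb, le_div_iff₀ (by positivity)]
      nlinarith [mul_le_mul_of_nonneg_left (ihc (d + 1)) h1.le,
        mul_le_mul_of_nonneg_left ih h2.le]

/-- Union bound for the crossings of red count `d` at large green counts. -/
lemma real_iUnion_stepAt_false_le {K ρ : ℝ}
    (hK : ∀ k n, 1 ≤ k → ∑ j ∈ Finset.range n, (w (k + j))⁻¹ ≤ K * (k : ℝ) ^ (1 - ρ)) (c d : ℕ) :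
    P.real (⋃ j, stepAt false (c + j) d) ≤
      density w a b P 0 0 * (K * ((a + c : ℕ) : ℝ) ^ (1 - ρ)) := by
  have h0 := (density_zero_zero_pos (P := P) hw ha hb).le
  refine measureReal_iUnion_le_of_sum_le fun n => ?_
  refine le_trans ?_ (mul_le_mul_of_nonneg_left (hK (a + c) n (by omega)) h0)
  rw [Finset.mul_sum]
  refine Finset.sum_le_sum fun j _ => ?_
  rw [real_stepAt_false hP hw ha hb, div_eq_mul_inv, ← add_assoc]
  exact mul_le_mul_of_nonneg_right (density_le hP hw ha hb _ _)
    (inv_pos.2 (hw _ (by omega))).le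

/-- Union bound for the crossings of green count `c` at large red counts. -/
lemma real_iUnion_stepAt_true_le {K ρ : ℝ}
    (hK : ∀ k n, 1 ≤ k → ∑ j ∈ Finset.range n, (w (k + j))⁻¹ ≤ K * (k : ℝ) ^ (1 - ρ)) (c d : ℕ) :
    P.real (⋃ j, stepAt true c (d + j)) ≤
      density w a b P 0 0 * (K * ((b + d : ℕ) : ℝ) ^ (1 - ρ)) := by
  have h0 := (density_zero_zero_pos (P := P) hw ha hb).le
  refine measureReal_iUnion_le_of_sum_le fun n => ?_
  refine le_trans ?_ (mul_le_mul_of_nonneg_left (hK (b + d) n (by omega)) h0)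
  rw [Finset.mul_sum]
  refine Finset.sum_le_sum fun j _ => ?_
  rw [real_stepAt_true hP hw ha hb, div_eq_mul_inv, ← add_assoc]
  exact mul_le_mul_of_nonneg_right (density_le hP hw ha hb _ _)
    (inv_pos.2 (hw _ (by omega))).le

/-- The last red step is taken at green count `c` and red count `d`. -/
def lastRed (c d : ℕ) : Set (ℕ → Bool) := stepAt false c d ∩ {ω | ∀ j, ω (c + d + 1 + j) = true}

omit [IsProbabilityMeasure P] hP hw ha hb in
lemma measurableSet_lastRed (c d : ℕ) : MeasurableSet (lastRed c d) := by
  refine (measurableSet_stepAt _ _ _).inter ?_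
  rw [Set.ofPred_forall]
  exact MeasurableSet.iInter fun j => measurableSet_coord _ _

lemma le_real_lastRed {L S : ℝ} (c d : ℕ) (hL : L ≤ density w a b P c d)
    (hS : ∀ n, w (b + (d + 1)) * ∑ j ∈ Finset.range n, (w (a + c + j))⁻¹ ≤ S) :
    L * Real.exp (-S) * (w (a + c))⁻¹ ≤ P.real (lastRed c d) := by
  let A : ℕ → Set (ℕ → Bool) := fun m =>
    stepAt false c d ∩ {ω | ∀ j < m, ω (c + d + 1 + j) = true}
  have hAsucc : ∀ m, A (m + 1) = A m ∩ {ω | ω (c + d + 1 + m) = true} := by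
    intro m
    ext ω
    simp only [A, Set.mem_inter_iff, Set.mem_ofPred_eq, and_assoc, Nat.lt_succ_iff_lt_or_eq]
    refine and_congr_right fun _ => ⟨fun h => ⟨fun j hj => h j (Or.inl hj), h m (Or.inr rfl)⟩, ?_⟩
    rintro ⟨h, h'⟩ j (hj | rfl)
    exacts [h j hj, h']
  have hcount : ∀ m, ∀ ω ∈ A m, greenCount ω (c + d + 1 + m) = c + m := by
    intro m
    induction m with
    | zero =>
      rintro ω ⟨⟨h1, h2⟩, -⟩
      simp [greenCount_succ, h1, h2]
    | succ m ih =>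
      intro ω hω
      rw [hAsucc] at hω
      have h2 : ω (c + d + 1 + m) = true := hω.2
      rw [← add_assoc, greenCount_succ, ih ω hω.1, h2]
      rfl
  have hdep : ∀ m, ∀ ω ω' : ℕ → Bool, (∀ j < c + d + 1 + m, ω j = ω' j) → ω ∈ A m → ω' ∈ A m := by
    rintro m ω ω' h ⟨⟨h1, h2⟩, h3⟩
    refine ⟨⟨?_, ?_⟩, fun j hj => ?_⟩
    · rw [← greenCount_congr fun j hj => h j (by omega)]; exact h1
    · rw [← h _ (by omega)]; exact h2
    · rw [← h _ (by omega)]; exact h3 j hj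
  have hb1 := hw (b + (d + 1)) (by omega)
  have hA : ∀ m, P.real (stepAt false c d) *
      Real.exp (-(w (b + (d + 1)) * ∑ j ∈ Finset.range m, (w (a + c + j))⁻¹)) ≤ P.real (A m) := by
    intro m
    induction m with
    | zero => simp [A]
    | succ m ih =>
      have hg := hw (a + c + m) (by omega)
      rw [hAsucc, hP.real_inter_step (hdep m) (hcount m), if_pos rfl, Finset.sum_range_succ, mul_add,
        neg_add, Real.exp_add, ← mul_assoc, show c + d + 1 + m - (c + m) = d + 1 by omega,
        ← add_assoc a]
      exact mul_le_mul ih (exp_neg_le_div hg hb1) (Real.exp_pos _).le measureReal_nonneg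
  have hlim : lastRed c d = ⋂ m, A m := by
    ext ω
    simp only [lastRed, A, Set.mem_inter_iff, Set.mem_iInter, Set.mem_ofPred_eq]
    exact ⟨fun h m => ⟨h.1, fun j _ => h.2 j⟩,
      fun h => ⟨(h 0).1, fun j => (h (j + 1)).2 j (by omega)⟩⟩
  have hAm : ∀ m, MeasurableSet (A m) := by
    intro m
    induction m with
    | zero => simpa [A] using measurableSet_stepAt _ _ _
    | succ m ih => rw [hAsucc]; exact ih.inter (measurableSet_coord _ _)
  have ht : Filter.Tendsto (fun m => P.real (A m)) Filter.atTop (nhds (P.real (lastRed c d))) := by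
    rw [hlim]
    refine (ENNReal.tendsto_toReal (measure_ne_top _ _)).comp
      (tendsto_measure_iInter_atTop (fun m => (hAm m).nullMeasurableSet) ?_ ⟨0, measure_ne_top _ _⟩)
    exact antitone_nat_of_succ_le fun m => by rw [hAsucc]; exact Set.inter_subset_left
  refine ge_of_tendsto' ht fun m => le_trans ?_ (hA m)
  have hac := hw (a + c) (by omega)
  rw [real_stepAt_false hP hw ha hb, div_eq_mul_inv, mul_right_comm]
  have h0 := density_nonneg (P := P) hw ha hb c d
  gcongr
  exact hS m

end Law

section Time

variable {a b : ℕ}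

/-- The `i`-th step increments the strictly smaller edge weight. -/
def weakStep (a b i : ℕ) (ω : ℕ → Bool) : Prop :=
  Z a b ω (a + b + i) ≠ Z a b ω (a + b + i + 1)

lemma weakStep_iff (i : ℕ) (ω : ℕ → Bool) :
    weakStep a b i ω ↔ ∃ c d, c + d = i ∧
      ((b + d < a + c ∧ ω ∈ stepAt false c d) ∨ (a + c < b + d ∧ ω ∈ stepAt true c d)) := by
  have hle := greenCount_le ω i
  have key : weakStep a b i ω ↔
      (b + (i - greenCount ω i) < a + greenCount ω i ∧ ω i = false) ∨
      (a + greenCount ω i < b + (i - greenCount ω i) ∧ ω i = true) := by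
    unfold weakStep Z Gw Rw
    rw [Nat.add_sub_cancel_left, show a + b + i + 1 - (a + b) = i + 1 by omega, greenCount_succ]
    cases ω i <;> simp <;> omega
  rw [key]
  constructor
  · intro h
    refine ⟨greenCount ω i, i - greenCount ω i, by omega, ?_⟩
    simpa [stepAt, Nat.add_sub_cancel' hle] using h
  · rintro ⟨c, d, rfl, h⟩
    simp only [stepAt, Set.mem_ofPred_eq] at h
    rcases h with ⟨h1, h2, h3⟩ | ⟨h1, h2, h3⟩
    · left; rw [h2]; exact ⟨by omega, h3⟩
    · right; rw [h2]; exact ⟨by omega, h3⟩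

lemma Tattr_le {n : ℕ} {ω : ℕ → Bool} (h : ∀ i, n ≤ i → ¬ weakStep a b i ω) :
    Tattr a b ω ≤ ((a + b + n : ℕ) : ℕ∞) := by
  refine sInf_le ⟨a + b + n, rfl, by omega, fun l hl => ?_⟩
  have := h (l - (a + b)) (by omega)
  rw [weakStep, not_not] at this
  rwa [Nat.add_sub_cancel' (by omega)] at this

lemma le_Tattr {i : ℕ} {ω : ℕ → Bool} (h : weakStep a b i ω) :
    ((a + b + i : ℕ) : ℕ∞) ≤ Tattr a b ω := by
  refine le_sInf ?_
  rintro t ⟨k, rfl, hk, hl⟩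
  by_contra hlt
  have hlt' : k < a + b + i := by exact_mod_cast not_le.1 hlt
  exact h (hl _ hlt'.le)

/-- Some step from the `n`-th on increments the strictly smaller edge weight. -/
def lateWeakStep (a b n : ℕ) : Set (ℕ → Bool) := {ω | ∃ i, n ≤ i ∧ weakStep a b i ω}

lemma measurableSet_lateWeakStep (n : ℕ) : MeasurableSet (lateWeakStep a b n) := by
  have hZ : ∀ m, Measurable fun ω => Z a b ω m := fun m =>
    (measurable_const.add (measurable_greenCount _)).min
      (measurable_const.add (measurable_const.sub (measurable_greenCount _)))
  have : lateWeakStep a b n = ⋃ i, ⋃ (_ : n ≤ i), {ω | weakStep a b i ω} := by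
    ext; simp [lateWeakStep]
  rw [this]
  exact MeasurableSet.iUnion fun i => MeasurableSet.iUnion fun _ =>
    (measurableSet_eq_fun (hZ _) (hZ _)).compl

/-- A late step of the smaller edge either happens below level `m`, or requires both edges to
exceed level `m`. -/
lemma lateWeakStep_subset {m : ℕ} (ham : a ≤ m) (hbm : b ≤ m) (n : ℕ) :
    lateWeakStep a b n ⊆
      ((⋃ d ∈ Finset.range (m + 1), ⋃ j, stepAt false (n - d + j) d) ∪
        ⋃ c ∈ Finset.range (m + 1), ⋃ j, stepAt true c (n - c + j)) ∪
      ((⋃ j, stepAt false (m + 1 - a + j) (m - b)) ∪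
        ⋃ j, stepAt true (m - a) (m + 1 - b + j)) := by
  rintro ω ⟨i, hi, hw⟩
  obtain ⟨c, d, rfl, h⟩ := (weakStep_iff i ω).1 hw
  have hcross : ∀ i, m < a + greenCount ω i → m < b + (i - greenCount ω i) →
      ω ∈ ((⋃ j, stepAt false (m + 1 - a + j) (m - b)) ∪
        ⋃ j, stepAt true (m - a) (m + 1 - b + j)) := by
    intro i
    induction i with
    | zero => intro h1; simp at h1; omega
    | succ i ih =>
      have hle := greenCount_le ω i
      rw [greenCount_succ]
      cases hx : ω i
      · simp only [Bool.false_eq_true, if_false, add_zero]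
        intro h1 h2
        by_cases h : m < b + (i - greenCount ω i)
        · exact ih h1 h
        · refine Or.inl (Set.mem_iUnion.2 ⟨greenCount ω i - (m + 1 - a), ?_⟩)
          rw [Nat.add_sub_cancel' (by omega)]
          have : greenCount ω i + (m - b) = i := by omega
          simp [stepAt, this, hx]
      · simp only [if_true]
        intro h1 h2
        by_cases h : m < a + greenCount ω i
        · exact ih h (by omega)
        · refine Or.inr (Set.mem_iUnion.2 ⟨i - greenCount ω i - (m + 1 - b), ?_⟩)
          rw [Nat.add_sub_cancel' (by omega)]
          have h3 : m - a + (i - greenCount ω i) = i := by omega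
          simp only [stepAt, Set.mem_ofPred_eq, h3, hx, and_true]
          omega
  rcases h with ⟨h1, h2⟩ | ⟨h1, h2⟩
  · by_cases hd : b + d ≤ m
    · refine Or.inl (Or.inl ?_)
      simp only [Set.mem_iUnion, Finset.mem_range]
      refine ⟨d, by omega, c - (n - d), ?_⟩
      rwa [Nat.add_sub_cancel' (by omega)]
    · refine Or.inr (hcross (c + d) ?_ ?_) <;> rw [h2.1] <;> omega
  · by_cases hd : a + c ≤ m
    · refine Or.inl (Or.inr ?_)
      simp only [Set.mem_iUnion, Finset.mem_range]
      refine ⟨c, by omega, d - (n - c), ?_⟩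
      rwa [Nat.add_sub_cancel' (by omega)]
    · refine Or.inr (hcross (c + d) ?_ ?_) <;> rw [h2.1] <;> omega

lemma Tattr_le_tsum (ω : ℕ → Bool) :
    ENat.toENNReal (Tattr a b ω) ≤
      ((a + b : ℕ) : ENNReal) + ∑' n, (lateWeakStep a b n).indicator (fun _ => (1 : ENNReal)) ω := by
  classical
  by_cases h : ∃ n, ω ∉ lateWeakStep a b n
  · have hlt : ∀ n < Nat.find h, ω ∈ lateWeakStep a b n := fun n hn => by
      simpa using Nat.find_min h hn
    have hT : Tattr a b ω ≤ ((a + b + Nat.find h : ℕ) : ℕ∞) :=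
      Tattr_le fun i hi hwk => Nat.find_spec h ⟨i, hi, hwk⟩
    calc ENat.toENNReal (Tattr a b ω) ≤ ENat.toENNReal ((a + b + Nat.find h : ℕ) : ℕ∞) :=
          ENat.toENNReal_le.2 hT
      _ = ((a + b : ℕ) : ENNReal) + ∑ n ∈ Finset.range (Nat.find h),
            (lateWeakStep a b n).indicator (fun _ => (1 : ENNReal)) ω := by
          rw [Finset.sum_congr rfl fun n hn =>
            Set.indicator_of_mem (hlt n (Finset.mem_range.1 hn)) _]
          simp
      _ ≤ _ := by gcongr; exact ENNReal.sum_le_tsum _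
  · push Not at h
    have : ∑' n, (lateWeakStep a b n).indicator (fun _ => (1 : ENNReal)) ω = ⊤ := by
      simp [Set.indicator_of_mem (h _)]
    simp [this]

lemma lintegral_Tattr_ne_top {P : Measure (ℕ → Bool)} [IsProbabilityMeasure P]
    (h : Summable fun n => P.real (lateWeakStep a b n)) :
    ∫⁻ ω, ENat.toENNReal (Tattr a b ω) ∂P ≠ ⊤ := by
  refine ne_top_of_le_ne_top ?_ (lintegral_mono Tattr_le_tsum)
  rw [lintegral_add_left measurable_const, lintegral_tsum fun n =>
    (measurable_const.indicator (measurableSet_lateWeakStep n)).aemeasurable]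
  simp only [lintegral_const, measure_univ, mul_one,
    lintegral_indicator (measurableSet_lateWeakStep _), one_mul, Measure.restrict_apply_univ]
  refine ENNReal.add_ne_top.2 ⟨ENNReal.natCast_ne_top _, ?_⟩
  simpa [measureReal_def, ENNReal.ofReal_toReal (measure_ne_top _ _)] using
    h.tsum_ofReal_ne_top

lemma pairwise_disjoint_lastRed :
    Pairwise (Function.onFun Disjoint fun p : ℕ × ℕ => lastRed p.1 p.2) := by
  rintro ⟨c, d⟩ ⟨c', d'⟩ hne
  refine Set.disjoint_left.2 ?_
  rintro ω ⟨⟨h1, h2⟩, h3⟩ ⟨⟨h1', h2'⟩, h3'⟩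
  rcases lt_trichotomy (c + d) (c' + d') with h | h | h
  · have := h3 (c' + d' - (c + d + 1))
    rw [Nat.add_sub_cancel' (by omega), h2'] at this
    exact Bool.false_ne_true this
  · refine hne ?_
    rw [← h] at h1'
    have : c = c' := h1.symm.trans h1'
    exact Prod.ext this (by simp only; omega)
  · have := h3' (c + d - (c' + d' + 1))
    rw [Nat.add_sub_cancel' (by omega), h2] at this
    exact Bool.false_ne_true this

lemma tsum_le_lintegral_Tattr {P : Measure (ℕ → Bool)} [IsProbabilityMeasure P] :
    ∑' c, ∑' d, (if b + d < a + c then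
      ENNReal.ofReal (((a + c : ℕ) : ℝ) * P.real (lastRed c d)) else 0) ≤
    ∫⁻ ω, ENat.toENNReal (Tattr a b ω) ∂P := by
  rw [← ENNReal.tsum_prod (f := fun c d => if b + d < a + c then
      ENNReal.ofReal (((a + c : ℕ) : ℝ) * P.real (lastRed c d)) else 0)]
  refine le_trans ?_ (setLIntegral_le_lintegral (⋃ p : ℕ × ℕ, lastRed p.1 p.2) _)
  rw [lintegral_iUnion (fun p => measurableSet_lastRed _ _) pairwise_disjoint_lastRed]
  refine ENNReal.tsum_le_tsum fun p => ?_
  split_ifs with h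
  · rw [ENNReal.ofReal_mul (Nat.cast_nonneg _), ENNReal.ofReal_natCast, measureReal_def,
      ENNReal.ofReal_toReal (measure_ne_top _ _), ← setLIntegral_const]
    refine setLIntegral_mono' (measurableSet_lastRed _ _) fun ω hω => ?_
    have hT := le_Tattr ((weakStep_iff (a := a) (b := b) (p.1 + p.2) ω).2
      ⟨p.1, p.2, rfl, Or.inl ⟨h, hω.1⟩⟩)
    have hle : ((a + p.1 : ℕ) : ℕ∞) ≤ Tattr a b ω :=
      le_trans (by exact_mod_cast (by omega : a + p.1 ≤ a + b + (p.1 + p.2))) hT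
    simpa using ENat.toENNReal_le.2 hle
  · exact zero_le

end Time

section PowerWeights

lemma inv_rpow_le_sub {ρ x : ℝ} (hρ : 1 < ρ) (hx : 1 ≤ x) :
    (x ^ ρ)⁻¹ ≤ 2 ^ ρ / (ρ - 1) * (x ^ (1 - ρ) - (x + 1) ^ (1 - ρ)) := by
  have hx0 : 0 < x := by linarith
  have hρ' : 0 < ρ - 1 := by linarith
  have hy0 : 0 < x + 1 := by linarith
  have hs : 0 < x / (x + 1) := by positivity
  have hstep : (x + 1) ^ (1 - ρ) * (1 + (ρ - 1) / (x + 1)) ≤ x ^ (1 - ρ) := by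
    have hbern : 1 + (ρ - 1) / (x + 1) ≤ (x / (x + 1)) ^ (1 - ρ) := by
      rw [Real.rpow_def_of_pos hs]
      have hlog := Real.log_le_sub_one_of_pos hs
      have heq : x / (x + 1) - 1 = -(1 / (x + 1)) := by field_simp; ring
      rw [heq] at hlog
      refine le_trans ?_ (Real.add_one_le_exp _)
      have := mul_le_mul_of_nonneg_right hlog hρ'.le
      have e : (ρ - 1) / (x + 1) = 1 / (x + 1) * (ρ - 1) := by ring
      rw [e]
      linarith
    refine (mul_le_mul_of_nonneg_left hbern (by positivity)).trans (le_of_eq ?_)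
    rw [Real.div_rpow hx0.le hy0.le]
    field_simp
  have hpow : (x + 1) ^ (1 - ρ) = (x + 1) * ((x + 1) ^ ρ)⁻¹ := by
    rw [Real.rpow_sub hy0, Real.rpow_one, div_eq_mul_inv]
  have hdouble : (x + 1) ^ ρ ≤ 2 ^ ρ * x ^ ρ := by
    rw [← Real.mul_rpow (by norm_num) hx0.le]
    exact Real.rpow_le_rpow hy0.le (by linarith) (by linarith)
  have hdiff : (ρ - 1) * ((x + 1) ^ ρ)⁻¹ ≤ x ^ (1 - ρ) - (x + 1) ^ (1 - ρ) := by
    have : (x + 1) ^ (1 - ρ) * (1 + (ρ - 1) / (x + 1)) =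
        (x + 1) ^ (1 - ρ) + (ρ - 1) * ((x + 1) ^ ρ)⁻¹ := by
      rw [hpow]; field_simp
    linarith
  have hxr : 0 < x ^ ρ := by positivity
  have hyr : 0 < (x + 1) ^ ρ := by positivity
  calc (x ^ ρ)⁻¹ ≤ 2 ^ ρ * ((x + 1) ^ ρ)⁻¹ := by
        rw [inv_eq_one_div, ← div_eq_mul_inv, div_le_div_iff₀ hxr hyr]
        linarith
    _ = 2 ^ ρ / (ρ - 1) * ((ρ - 1) * ((x + 1) ^ ρ)⁻¹) := by field_simp
    _ ≤ _ := by gcongr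

lemma sum_inv_rpow_le {ρ : ℝ} (hρ : 1 < ρ) (k n : ℕ) (hk : 1 ≤ k) :
    ∑ j ∈ Finset.range n, (((k + j : ℕ) : ℝ) ^ ρ)⁻¹ ≤ 2 ^ ρ / (ρ - 1) * (k : ℝ) ^ (1 - ρ) := by
  have hρ' : 0 < ρ - 1 := by linarith
  have key : ∑ j ∈ Finset.range n, (((k + j : ℕ) : ℝ) ^ ρ)⁻¹ ≤
      2 ^ ρ / (ρ - 1) * ((k : ℝ) ^ (1 - ρ) - ((k + n : ℕ) : ℝ) ^ (1 - ρ)) := by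
    induction n with
    | zero => simp
    | succ n ih =>
      rw [Finset.sum_range_succ]
      have h := inv_rpow_le_sub (x := ((k + n : ℕ) : ℝ)) hρ (by exact_mod_cast (by omega))
      have e : ((k + (n + 1) : ℕ) : ℝ) = ((k + n : ℕ) : ℝ) + 1 := by push_cast; ring
      rw [e]
      linarith
  refine key.trans (mul_le_mul_of_nonneg_left ?_ (by positivity))
  linarith [Real.rpow_nonneg (Nat.cast_nonneg (α := ℝ) (k + n)) (1 - ρ)]

lemma quadratic_nonpos_iff {ρ : ℝ} (hρ : 1 < ρ) :
    ρ ≤ (3 + Real.sqrt 5) / 2 ↔ ρ ^ 2 - 3 * ρ + 1 ≤ 0 := by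
  have h5 : Real.sqrt 5 ^ 2 = 5 := Real.sq_sqrt (by norm_num)
  have h1 : 1 < Real.sqrt 5 := Real.lt_sqrt_of_sq_lt (by norm_num)
  have e : ρ ^ 2 - 3 * ρ + 1 = (ρ - (3 + Real.sqrt 5) / 2) * (ρ - (3 - Real.sqrt 5) / 2) := by
    ring_nf
    rw [h5]
    ring
  have h2 : 0 < ρ - (3 - Real.sqrt 5) / 2 := by linarith
  rw [e]
  constructor
  · intro h
    exact mul_nonpos_of_nonpos_of_nonneg (by linarith) h2.le
  · intro h
    by_contra! h'
    exact absurd (mul_pos (by linarith) h2) (not_lt.2 h)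

variable {ρ : ℝ} {w : ℕ → ℝ} {a b : ℕ} {P : Measure (ℕ → Bool)} [IsProbabilityMeasure P]
  (hρ : 1 < ρ) (hwdef : ∀ k : ℕ, 1 ≤ k → w k = (k : ℝ) ^ ρ) (ha : 1 ≤ a) (hb : 1 ≤ b)
  (hP : IsTwoEdgeLaw w a b P)

include hwdef

lemma weight_pos (k : ℕ) (hk : 1 ≤ k) : 0 < w k := by
  have : (0 : ℝ) < k := by exact_mod_cast hk
  rw [hwdef k hk]
  positivity

include hρ

lemma sum_inv_weight_le (k n : ℕ) (hk : 1 ≤ k) :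
    ∑ j ∈ Finset.range n, (w (k + j))⁻¹ ≤ 2 ^ ρ / (ρ - 1) * (k : ℝ) ^ (1 - ρ) := by
  refine le_trans (le_of_eq ?_) (sum_inv_rpow_le hρ k n hk)
  exact Finset.sum_congr rfl fun j _ => by rw [hwdef _ (by omega)]

include ha hb hP

lemma real_lateWeakStep_le {m n : ℕ} (ham : a ≤ m) (hbm : b ≤ m) (hmn : 2 * m ≤ n) :
    P.real (lateWeakStep a b n) ≤
      2 * (density w a b P 0 0 * (2 ^ ρ / (ρ - 1))) *
        ((m + 1) * ((n : ℝ) / 2) ^ (1 - ρ) + ((m : ℝ) + 1) ^ (1 - ρ)) := by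
  have hw := weight_pos hwdef
  have hK := sum_inv_weight_le hρ hwdef
  have hD := (density_zero_zero_pos (P := P) hw ha hb).le
  have hρ' : 0 < ρ - 1 := by linarith
  have hn0 : (0 : ℝ) < n := by exact_mod_cast (by omega)
  have hpow : ∀ s t : ℕ, 1 ≤ s → t ≤ m →
      ((s + (n - t) : ℕ) : ℝ) ^ (1 - ρ) ≤ ((n : ℝ) / 2) ^ (1 - ρ) := by
    intro s t hs ht
    refine Real.rpow_le_rpow_of_nonpos (by positivity) ?_ (by linarith)
    have : (n : ℝ) ≤ 2 * ((s + (n - t) : ℕ) : ℝ) := by exact_mod_cast (by omega)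
    linarith
  have hfar : ∀ s : ℕ, s ≤ m → ((s + (m + 1 - s) : ℕ) : ℝ) = (m : ℝ) + 1 := by
    intro s hs
    rw [Nat.add_sub_cancel' (by omega)]
    push_cast
    ring
  have h1 : P.real (⋃ d ∈ Finset.range (m + 1), ⋃ j, stepAt false (n - d + j) d) ≤
      (m + 1) * (density w a b P 0 0 * (2 ^ ρ / (ρ - 1) * ((n : ℝ) / 2) ^ (1 - ρ))) := by
    refine (measureReal_biUnion_finset_le _ _).trans ?_
    refine (Finset.sum_le_card_nsmul _ _
      (density w a b P 0 0 * (2 ^ ρ / (ρ - 1) * ((n : ℝ) / 2) ^ (1 - ρ))) fun d hd =>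
      (real_iUnion_stepAt_false_le hP hw ha hb hK (n - d) d).trans ?_).trans (le_of_eq ?_)
    · have := hpow a d ha (by simpa [Nat.lt_succ_iff] using hd)
      gcongr
    · simp
  have h2 : P.real (⋃ c ∈ Finset.range (m + 1), ⋃ j, stepAt true c (n - c + j)) ≤
      (m + 1) * (density w a b P 0 0 * (2 ^ ρ / (ρ - 1) * ((n : ℝ) / 2) ^ (1 - ρ))) := by
    refine (measureReal_biUnion_finset_le _ _).trans ?_
    refine (Finset.sum_le_card_nsmul _ _
      (density w a b P 0 0 * (2 ^ ρ / (ρ - 1) * ((n : ℝ) / 2) ^ (1 - ρ))) fun d hd =>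
      (real_iUnion_stepAt_true_le hP hw ha hb hK d (n - d)).trans ?_).trans (le_of_eq ?_)
    · have := hpow b d hb (by simpa [Nat.lt_succ_iff] using hd)
      gcongr
    · simp
  have h3 := real_iUnion_stepAt_false_le hP hw ha hb hK (m + 1 - a) (m - b)
  have h4 := real_iUnion_stepAt_true_le hP hw ha hb hK (m - a) (m + 1 - b)
  rw [hfar a ham] at h3
  rw [hfar b hbm] at h4
  refine (measureReal_mono (lateWeakStep_subset ham hbm n)).trans ?_
  refine (measureReal_union_le _ _).trans ?_
  refine (add_le_add (measureReal_union_le _ _) (measureReal_union_le _ _)).trans ?_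
  linarith

lemma summable_real_lateWeakStep (h : 0 < ρ ^ 2 - 3 * ρ + 1) :
    Summable fun n => P.real (lateWeakStep a b n) := by
  have hρ0 : 0 < ρ := by linarith
  have hD := (density_zero_zero_pos (P := P) (weight_pos hwdef) ha hb).le
  have hρ' : 0 < ρ - 1 := by linarith
  set α : ℝ := (ρ - 1) / ρ with hα
  set β : ℝ := (ρ - 1) ^ 2 / ρ with hβ
  have hα0 : 0 < α := by positivity
  have hα1 : 0 < 1 - α := by
    have : 1 - α = 1 / ρ := by rw [hα]; field_simp; ring
    rw [this]; positivity
  have hβ1 : 1 < β := by rw [hβ, lt_div_iff₀ hρ0]; nlinarith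
  have e1 : α + (1 - ρ) = -β := by rw [hα, hβ]; field_simp; ring
  have e2 : α * (1 - ρ) = -β := by rw [hα, hβ]; field_simp; ring
  have ev1 : ∀ᶠ n : ℕ in Filter.atTop, ((a + b : ℕ) : ℝ) ≤ (n : ℝ) ^ α :=
    ((tendsto_rpow_atTop hα0).comp tendsto_natCast_atTop_atTop).eventually_ge_atTop _
  have ev2 : ∀ᶠ n : ℕ in Filter.atTop, (2 : ℝ) ≤ (n : ℝ) ^ (1 - α) :=
    ((tendsto_rpow_atTop hα1).comp tendsto_natCast_atTop_atTop).eventually_ge_atTop _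
  refine Summable.of_norm_bounded_eventually_nat (g := fun n : ℕ =>
    2 * (density w a b P 0 0 * (2 ^ ρ / (ρ - 1))) * (2 * 2 ^ (ρ - 1) + 1) * (n : ℝ) ^ (-β))
    ((Real.summable_nat_rpow.2 (by linarith)).mul_left _) ?_
  filter_upwards [ev1, ev2, Filter.eventually_ge_atTop 1] with n h1 h2 hn
  have hn0 : (0 : ℝ) < n := by exact_mod_cast hn
  have hnα : 0 < (n : ℝ) ^ α := by positivity
  have hn1 : 1 ≤ (n : ℝ) ^ α := Real.one_le_rpow (by exact_mod_cast hn) hα0.le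
  have hab : a + b ≤ ⌊(n : ℝ) ^ α⌋₊ := Nat.le_floor h1
  have hfl : (⌊(n : ℝ) ^ α⌋₊ : ℝ) ≤ (n : ℝ) ^ α := Nat.floor_le hnα.le
  have hfl' : (n : ℝ) ^ α ≤ (⌊(n : ℝ) ^ α⌋₊ : ℝ) + 1 := (Nat.lt_floor_add_one _).le
  have hmn : 2 * ⌊(n : ℝ) ^ α⌋₊ ≤ n := by
    have : (n : ℝ) ^ α * (n : ℝ) ^ (1 - α) = n := by
      rw [← Real.rpow_add hn0, add_sub_cancel, Real.rpow_one]
    have h3 : 2 * (⌊(n : ℝ) ^ α⌋₊ : ℝ) ≤ n := by nlinarith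
    exact_mod_cast h3
  rw [Real.norm_of_nonneg measureReal_nonneg]
  refine (real_lateWeakStep_le hρ hwdef ha hb hP (by omega) (by omega) hmn).trans ?_
  rw [mul_assoc (2 * _)]
  refine mul_le_mul_of_nonneg_left ?_ (by positivity)
  have hA : ((⌊(n : ℝ) ^ α⌋₊ : ℝ) + 1) * ((n : ℝ) / 2) ^ (1 - ρ) ≤
      2 * 2 ^ (ρ - 1) * (n : ℝ) ^ (-β) := by
    rw [← e1, Real.rpow_add hn0, Real.div_rpow hn0.le (by norm_num),
      show (2 : ℝ) ^ (1 - ρ) = (2 ^ (ρ - 1))⁻¹ by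
        rw [← Real.rpow_neg (by norm_num)]; congr 1; ring, div_inv_eq_mul]
    calc _ ≤ (2 * (n : ℝ) ^ α) * ((n : ℝ) ^ (1 - ρ) * 2 ^ (ρ - 1)) := by
          gcongr; linarith
      _ = _ := by ring
  have hB : ((⌊(n : ℝ) ^ α⌋₊ : ℝ) + 1) ^ (1 - ρ) ≤ (n : ℝ) ^ (-β) := by
    rw [← e2, Real.rpow_mul hn0.le]
    exact Real.rpow_le_rpow_of_nonpos hnα hfl' (by linarith)
  linarith

lemma exists_le_real_lastRed : ∃ δ : ℝ, 0 < δ ∧ ∀ c d : ℕ,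
    ((b + (d + 1) : ℕ) : ℝ) ≤ ((a + c : ℕ) : ℝ) ^ ((ρ - 1) / ρ) →
      δ * ((a + c : ℕ) : ℝ) ^ (-ρ) ≤ P.real (lastRed c d) := by
  have hw := weight_pos hwdef
  have hK := sum_inv_weight_le hρ hwdef
  have hD := density_zero_zero_pos (P := P) hw ha hb
  have hρ' : 0 < ρ - 1 := by linarith
  have hK0 : 0 < 2 ^ ρ / (ρ - 1) := by positivity
  set K : ℝ := 2 ^ ρ / (ρ - 1)
  have hS : ∀ k n, 1 ≤ k → ∑ j ∈ Finset.range n, (w (k + j))⁻¹ ≤ K := fun k n hk =>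
    (hK k n hk).trans (mul_le_of_le_one_right hK0.le
      (Real.rpow_le_one_of_one_le_of_nonpos (by exact_mod_cast hk) (by linarith)))
  refine ⟨density w a b P 0 0 * Real.exp (-((w a + w b) * K)) * Real.exp (-K), by positivity,
    fun c d hcd => ?_⟩
  have hg : (0 : ℝ) < ((a + c : ℕ) : ℝ) := by exact_mod_cast (by omega)
  refine le_trans (le_of_eq ?_) (le_real_lastRed hP hw ha hb c d
    (le_density hP hw ha hb hS c d) (S := K) fun n => ?_)
  · rw [hwdef (a + c) (by omega), Real.rpow_neg hg.le]
  · have h1 : w (b + (d + 1)) ≤ ((a + c : ℕ) : ℝ) ^ (ρ - 1) := by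
      rw [hwdef _ (by omega)]
      refine (Real.rpow_le_rpow (Nat.cast_nonneg _) hcd (by linarith)).trans (le_of_eq ?_)
      rw [← Real.rpow_mul hg.le]
      congr 1
      field_simp
    calc _ ≤ ((a + c : ℕ) : ℝ) ^ (ρ - 1) * (K * ((a + c : ℕ) : ℝ) ^ (1 - ρ)) :=
          mul_le_mul h1 (hK (a + c) n (by omega))
            (Finset.sum_nonneg fun j _ => (inv_pos.2 (hw _ (by omega))).le) (by positivity)
      _ = K * (((a + c : ℕ) : ℝ) ^ (ρ - 1) * ((a + c : ℕ) : ℝ) ^ (1 - ρ)) := by ring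
      _ = K := by rw [← Real.rpow_add hg]; simp

lemma lintegral_Tattr_eq_top (h : ρ ^ 2 - 3 * ρ + 1 ≤ 0) :
    ∫⁻ ω, ENat.toENNReal (Tattr a b ω) ∂P = ⊤ := by
  obtain ⟨δ, hδ, hlast⟩ := exists_le_real_lastRed hρ hwdef ha hb hP
  have hρ0 : 0 < ρ := by linarith
  have hρ' : 0 < ρ - 1 := by linarith
  set α : ℝ := (ρ - 1) / ρ with hα
  have hα0 : 0 < α := by positivity
  have hα1 : α ≤ 1 := by rw [hα, div_le_one hρ0]; linarith
  have hexp : -1 ≤ 1 - ρ + α := by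
    have : (1 - ρ + α + 1) * ρ = -(ρ ^ 2 - 3 * ρ + 1) := by rw [hα]; field_simp; ring
    nlinarith
  have ev : ∀ᶠ c : ℕ in Filter.atTop, (2 * (b + 1) : ℝ) ≤ ((a + c : ℕ) : ℝ) ^ α :=
    ((tendsto_rpow_atTop hα0).comp (tendsto_natCast_atTop_atTop.comp
      (Filter.tendsto_atTop_mono (fun c => Nat.le_add_left c a)
        Filter.tendsto_id))).eventually_ge_atTop _
  obtain ⟨c₀, hc₀⟩ := Filter.eventually_atTop.1 ev
  have hinner : ∀ c, c₀ ≤ c → ENNReal.ofReal (δ / 2 * ((a + c : ℕ) : ℝ)⁻¹) ≤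
      ∑' d, (if b + d < a + c then
        ENNReal.ofReal (((a + c : ℕ) : ℝ) * P.real (lastRed c d)) else 0) := by
    intro c hc
    have hg1 : (1 : ℝ) ≤ ((a + c : ℕ) : ℝ) := by exact_mod_cast (by omega)
    set g : ℝ := ((a + c : ℕ) : ℝ) with hg
    have hg0 : 0 < g := by linarith
    have hbig : (2 * (b + 1) : ℝ) ≤ g ^ α := hc₀ c hc
    have hgα : 0 ≤ g ^ α := by positivity
    have hfl : (⌊g ^ α⌋₊ : ℝ) ≤ g ^ α := Nat.floor_le hgα
    have hgle : ⌊g ^ α⌋₊ ≤ a + c := by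
      have : (⌊g ^ α⌋₊ : ℝ) ≤ g := hfl.trans <| by
        simpa using Real.rpow_le_rpow_of_exponent_le hg1 hα1
      exact Nat.cast_le.1 (show (⌊g ^ α⌋₊ : ℝ) ≤ ((a + c : ℕ) : ℝ) from this)
    have hM : g ^ α / 2 ≤ ((⌊g ^ α⌋₊ - b : ℕ) : ℝ) := by
      have h1 := Nat.lt_floor_add_one (g ^ α)
      have h2 : (⌊g ^ α⌋₊ : ℝ) ≤ ((⌊g ^ α⌋₊ - b : ℕ) : ℝ) + b := by
        exact_mod_cast (by omega)
      linarith
    calc ENNReal.ofReal (δ / 2 * g⁻¹)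
        ≤ ENNReal.ofReal (((⌊g ^ α⌋₊ - b : ℕ) : ℝ) * (g * (δ * g ^ (-ρ)))) := by
          refine ENNReal.ofReal_le_ofReal ?_
          have e : g ^ α / 2 * (g * (δ * g ^ (-ρ))) = δ / 2 * g ^ (1 - ρ + α) := by
            rw [show 1 - ρ + α = α + (1 + -ρ) by ring, Real.rpow_add hg0, Real.rpow_add hg0,
              Real.rpow_one]
            ring
          calc δ / 2 * g⁻¹ ≤ δ / 2 * g ^ (1 - ρ + α) := by
                rw [← Real.rpow_neg_one]
                gcongr
            _ ≤ _ := by rw [← e]; gcongr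
      _ = ∑ d ∈ Finset.range (⌊g ^ α⌋₊ - b), ENNReal.ofReal (g * (δ * g ^ (-ρ))) := by
          rw [Finset.sum_const, Finset.card_range, nsmul_eq_mul,
            ENNReal.ofReal_mul (Nat.cast_nonneg _), ENNReal.ofReal_natCast]
      _ ≤ ∑ d ∈ Finset.range (⌊g ^ α⌋₊ - b), (if b + d < a + c then
            ENNReal.ofReal (g * P.real (lastRed c d)) else 0) := by
          refine Finset.sum_le_sum fun d hd => ?_
          have hd' : b + (d + 1) ≤ ⌊g ^ α⌋₊ := by
            have := Finset.mem_range.1 hd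
            omega
          rw [if_pos (by omega)]
          refine ENNReal.ofReal_le_ofReal (mul_le_mul_of_nonneg_left (hlast c d ?_) hg0.le)
          exact le_trans (by exact_mod_cast hd') hfl
      _ ≤ _ := ENNReal.sum_le_tsum _
  by_contra hfin
  have hle := tsum_le_lintegral_Tattr (a := a) (b := b) (P := P)
  have hshift : ∑' c, ENNReal.ofReal (δ / 2 * ((a + (c + c₀) : ℕ) : ℝ)⁻¹) ≤
      ∫⁻ ω, ENat.toENNReal (Tattr a b ω) ∂P :=
    (ENNReal.tsum_le_tsum fun c => hinner (c + c₀) (Nat.le_add_left _ _)).trans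
      ((ENNReal.tsum_comp_le_tsum_of_injective (add_left_injective c₀) _).trans hle)
  have hsum := ENNReal.summable_toReal (ne_top_of_le_ne_top hfin hshift)
  have hsum' : Summable fun c : ℕ => ((c + (a + c₀) : ℕ) : ℝ)⁻¹ := by
    refine (summable_mul_left_iff (a := δ / 2) (by positivity)).1 (hsum.congr fun c => ?_)
    rw [ENNReal.toReal_ofReal (by positivity), show a + (c + c₀) = c + (a + c₀) by ring]
  exact Real.not_summable_natCast_inv
    ((summable_nat_add_iff (f := fun n : ℕ => ((n : ℕ) : ℝ)⁻¹) (a + c₀)).1 hsum')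

end PowerWeights

end AttractionTime

/-- Corollary 11: for `w(k) = k^ρ` with `ρ > 1` and
`P = P^{a,b}`, the expected attraction time `E^{a,b}[T]` (as an extended real
number) is infinite if `ρ ≤ (3+√5)/2` and finite if `ρ > (3+√5)/2`. -/
theorem stmt17 (ρ : ℝ) (hρ : 1 < ρ) (w : ℕ → ℝ)
    (hwdef : ∀ k : ℕ, 1 ≤ k → w k = (k : ℝ) ^ ρ)
    (a b : ℕ) (ha : 1 ≤ a) (hb : 1 ≤ b)
    (P : Measure (ℕ → Bool)) [IsProbabilityMeasure P]
    (hP : IsTwoEdgeLaw w a b P) :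
    (ρ ≤ (3 + Real.sqrt 5) / 2 →
        ∫⁻ ω, ENat.toENNReal (Tattr a b ω) ∂P = ⊤) ∧
      ((3 + Real.sqrt 5) / 2 < ρ →
        ∫⁻ ω, ENat.toENNReal (Tattr a b ω) ∂P ≠ ⊤) := by
  rw [← not_le, quadratic_nonpos_iff hρ, not_le]
  exact ⟨lintegral_Tattr_eq_top hρ hwdef ha hb hP, fun h =>
    lintegral_Tattr_ne_top (summable_real_lateWeakStep hρ hwdef ha hb hP h)⟩
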